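/- arXiv:1908.01871 — 5 statements merged into one kernel-verified Lean document; each statement's English description precedes it below -/
import Mathlib

section
/- Let X ⊆ ℝ^d be a convex set, let g : ℝ^d → ℝ, let ρ ≥ 0, ρ̂ > ρ, σ > 0, M ≥ 0, D ≥ 0, λ > 0, and let x, x̂ ∈ X with ‖x̂ − x‖ ≤ D. Suppose there exist vectors v_f, v_g, v_N ∈ ℝ^d such that: (i) ‖v_f‖ ≤ M; (ii) v_f + ρ̂(x̂ − x) + λ(v_g + ρ̂(x̂ − x)) + v_N = 0; (iii) g(y) ≥ g(x̂) + ⟪v_g, y − x̂⟫ − (ρ/2)‖y − x̂‖² for all y ∈ X (v_g is a subgradient of the ρ-weakly convex g at x̂); (iv) ⟪v_N, y − x̂⟫ ≤ 0 for all y ∈ X (v_N lies in the normal cone of X at x̂); (v) g(x̂) + (ρ̂/2)‖x̂ − x‖² ≥ 0; (vi) there exists ỹ ∈ X with g(ỹ) + (ρ̂/2)‖ỹ − x‖² ≤ −σ. Then λ ≤ (M + ρ̂ D)/√(2σ(ρ̂ − ρ)). -/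
open scoped RealInnerProductSpace

/-- Lemma 1: uniform bound on the Lagrange multiplier of the proximal subproblem. -/
theorem multiplier_bound {d : ℕ} (X : Set (EuclideanSpace ℝ (Fin d))) (hX : Convex ℝ X)
    (g : EuclideanSpace ℝ (Fin d) → ℝ) (ρ ρhat σ M D lam : ℝ)
    (x xhat : EuclideanSpace ℝ (Fin d))
    (hρ : 0 ≤ ρ) (hρhat : ρ < ρhat) (hσ : 0 < σ) (hM : 0 ≤ M) (hD : 0 ≤ D) (hlam : 0 < lam)
    (hxX : x ∈ X) (hxhatX : xhat ∈ X) (hdist : ‖xhat - x‖ ≤ D)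
    (vf vg vN : EuclideanSpace ℝ (Fin d))
    (hvf : ‖vf‖ ≤ M)
    (hstat : vf + ρhat • (xhat - x) + lam • (vg + ρhat • (xhat - x)) + vN = 0)
    (hsub : ∀ y ∈ X, g y ≥ g xhat + ⟪vg, y - xhat⟫ - ρ / 2 * ‖y - xhat‖ ^ 2)
    (hN : ∀ y ∈ X, ⟪vN, y - xhat⟫ ≤ 0)
    (hactive : g xhat + ρhat / 2 * ‖xhat - x‖ ^ 2 ≥ 0)
    (hslater : ∃ ytil ∈ X, g ytil + ρhat / 2 * ‖ytil - x‖ ^ 2 ≤ -σ) :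
    lam ≤ (M + ρhat * D) / Real.sqrt (2 * σ * (ρhat - ρ)) := by
  obtain ⟨y, hyX, hy⟩ := hslater
  have hρhat_nonneg : 0 ≤ ρhat := hρ.trans hρhat.le
  have h_sub := hsub y hyX
  have h_normal := hN y hyX
  have h_split : y - x = (y - xhat) + (xhat - x) := by abel
  rw [h_split, norm_add_sq_real] at hy
  set w := y - xhat
  set u := xhat - x
  have h_stat : ⟪vf + ρhat • u, w⟫ + lam * (⟪vg, w⟫ + ρhat * ⟪w, u⟫) + ⟪vN, w⟫ = 0 := by
    have h := congrArg (fun z => ⟪z, w⟫) hstat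
    simpa only [inner_add_left, real_inner_smul_left, inner_zero_left,
      real_inner_comm w u] using h
  have h_norm : ‖vf + ρhat • u‖ ≤ M + ρhat * D := by
    refine (norm_add_le _ _).trans (add_le_add hvf ?_)
    rw [norm_smul, Real.norm_of_nonneg hρhat_nonneg]
    exact mul_le_mul_of_nonneg_left hdist hρhat_nonneg
  have h_inner : ⟪vf + ρhat • u, w⟫ ≤ (M + ρhat * D) * ‖w‖ :=
    (real_inner_le_norm _ _).trans (mul_le_mul_of_nonneg_right h_norm (norm_nonneg w))
  have h_slater : σ + (ρhat - ρ) / 2 * ‖w‖ ^ 2 ≤ -(⟪vg, w⟫ + ρhat * ⟪w, u⟫) := by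
    linarith
  have h_growth : lam * (σ + (ρhat - ρ) / 2 * ‖w‖ ^ 2) ≤ (M + ρhat * D) * ‖w‖ := by
    have h := mul_le_mul_of_nonneg_left h_slater hlam.le
    linarith
  have h_gap : 0 < 2 * σ * (ρhat - ρ) := mul_pos (by linarith) (sub_pos.mpr hρhat)
  have hw : 0 < ‖w‖ := by
    refine (norm_nonneg w).lt_of_ne fun h => ?_
    rw [← h] at h_growth
    nlinarith [mul_pos hlam hσ]
  have h_amgm : √(2 * σ * (ρhat - ρ)) * ‖w‖ ≤ σ + (ρhat - ρ) / 2 * ‖w‖ ^ 2 := by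
    have h_sum : 0 ≤ σ + (ρhat - ρ) / 2 * ‖w‖ ^ 2 :=
      add_nonneg hσ.le (mul_nonneg (by linarith) (sq_nonneg _))
    refine abs_le_of_sq_le_sq' ?_ h_sum |>.2
    rw [mul_pow, Real.sq_sqrt h_gap.le]
    linarith [sq_nonneg (σ - (ρhat - ρ) / 2 * ‖w‖ ^ 2)]
  rw [le_div_iff₀ (Real.sqrt_pos.mpr h_gap)]
  refine le_of_mul_le_mul_right ?_ hw
  rw [mul_assoc]
  exact (mul_le_mul_of_nonneg_left h_amgm hlam.le).trans h_growth
end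

section
/- Let X ⊆ ℝ^d be a set, G : ℝ^d → ℝ, x̂ ∈ X, v ∈ ℝ^d, μ > 0 and σ > 0. Suppose G(y) ≥ G(x̂) + ⟪v, y − x̂⟫ + (μ/2)‖y − x̂‖² for all y ∈ X, that G(x̂) ≥ 0, and that there exists ỹ ∈ X with G(ỹ) ≤ −σ. Then ‖v‖² ≥ 2σμ. -/
open scoped RealInnerProductSpace

/-- Key step of Lemma 1: a lower bound on the subgradient norm of a strongly convex
constraint that is nonnegative at `xhat` but at most `-σ` somewhere on `X`. -/
theorem subgradient_norm_lower_bound {d : ℕ} (X : Set (EuclideanSpace ℝ (Fin d)))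
    (G : EuclideanSpace ℝ (Fin d) → ℝ) (xhat v : EuclideanSpace ℝ (Fin d)) (μ σ : ℝ)
    (hμ : 0 < μ) (hσ : 0 < σ) (hxhat : xhat ∈ X)
    (hgrow : ∀ y ∈ X, G y ≥ G xhat + ⟪v, y - xhat⟫ + μ / 2 * ‖y - xhat‖ ^ 2)
    (hnonneg : 0 ≤ G xhat)
    (hsl : ∃ y ∈ X, G y ≤ -σ) :
    2 * σ * μ ≤ ‖v‖ ^ 2 := by
  obtain ⟨y, hy, hyσ⟩ := hsl
  have hcs : -(‖v‖ * ‖y - xhat‖) ≤ ⟪v, y - xhat⟫ :=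
    neg_le_of_abs_le (abs_real_inner_le_norm v (y - xhat))
  have hσ_le : σ ≤ ‖v‖ * ‖y - xhat‖ - μ / 2 * ‖y - xhat‖ ^ 2 := by
    linarith [hgrow y hy]
  calc
    2 * σ * μ = 2 * μ * σ := by ring
    _ ≤ 2 * μ * (‖v‖ * ‖y - xhat‖ - μ / 2 * ‖y - xhat‖ ^ 2) := by gcongr
    _ = ‖v‖ ^ 2 - (‖v‖ - μ * ‖y - xhat‖) ^ 2 := by ring
    _ ≤ ‖v‖ ^ 2 := sub_le_self _ (sq_nonneg _)
end

section
/- Let X ⊆ ℝ^d be a convex set, let f, g : ℝ^d → ℝ be ρ-weakly convex on X with ρ ≥ 0, let ρ̂ > ρ, λ ≥ 0 and x ∈ X. Define L(y) = f(y) + (ρ̂/2)‖y − x‖² + λ (g(y) + (ρ̂/2)‖y − x‖²). Suppose x̂ ∈ X satisfies L(x̂) ≤ L(y) for all y ∈ X and λ (g(x̂) + (ρ̂/2)‖x̂ − x‖²) = 0. Then ((1 + λ)(ρ̂ − ρ)/2) ‖x − x̂‖² ≤ f(x) − f(x̂) + λ g(x) − (ρ̂/2)‖x̂ − x‖². -/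
open scoped RealInnerProductSpace

/-- A strongly convex function grows at least quadratically away from a minimizer. -/
theorem StrongConvexOn.add_sq_le_of_isMinOn {E : Type*} [NormedAddCommGroup E]
    [NormedSpace ℝ E] {s : Set E} {m : ℝ} {φ : E → ℝ} {a y : E}
    (hφ : StrongConvexOn s m φ) (hmin : IsMinOn φ s a) (ha : a ∈ s) (hy : y ∈ s) :
    φ a + m / 2 * ‖y - a‖ ^ 2 ≤ φ y := by
  have key : ∀ t ∈ Set.Ioo (0 : ℝ) 1, φ a + (1 - t) * (m / 2 * ‖y - a‖ ^ 2) ≤ φ y := by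
    rintro t ⟨ht0, ht1⟩
    have h1 := hφ.2 hy ha ht0.le (sub_nonneg.2 ht1.le) (by ring)
    have h2 := isMinOn_iff.1 hmin _ (hφ.1 hy ha ht0.le (sub_nonneg.2 ht1.le) (by ring))
    simp only [smul_eq_mul] at h1
    refine le_of_mul_le_mul_left ?_ ht0
    linarith
  have hlim : Filter.Tendsto (fun t : ℝ => φ a + (1 - t) * (m / 2 * ‖y - a‖ ^ 2))
      (nhdsWithin 0 (Set.Ioi 0)) (nhds (φ a + m / 2 * ‖y - a‖ ^ 2)) := by
    have hc : Continuous fun t : ℝ => φ a + (1 - t) * (m / 2 * ‖y - a‖ ^ 2) := by fun_prop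
    simpa using (hc.tendsto 0).mono_left nhdsWithin_le_nhds
  refine le_of_tendsto hlim ?_
  filter_upwards [Ioo_mem_nhdsGT (zero_lt_one' ℝ)] with t ht using key t ht

/-- Adding a quadratic centred at an arbitrary point makes a weakly convex function
strongly convex. -/
theorem ConvexOn.strongConvexOn_add_sq_norm_sub {E : Type*} [NormedAddCommGroup E]
    [InnerProductSpace ℝ E] {s : Set E} {h : E → ℝ} {r : ℝ}
    (hh : ConvexOn ℝ s (fun z => h z + r / 2 * ‖z‖ ^ 2)) (R : ℝ) (x : E) :
    StrongConvexOn s (R - r) (fun z => h z + R / 2 * ‖z - x‖ ^ 2) := by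
  rw [strongConvexOn_iff_convex]
  have hlin := ((-R) • innerSL ℝ x).toLinearMap.convexOn hh.1
  refine ((hh.add hlin).add_const (R / 2 * ‖x‖ ^ 2)).congr fun z _ => ?_
  simp only [Pi.add_apply, ContinuousLinearMap.coe_coe, smul_apply,
    innerSL_apply_apply, smul_eq_mul, norm_sub_sq_real, real_inner_comm x z]
  ring

/-- Inequality (PGSMeq2): quadratic growth of the strongly convex Lagrangian at its
minimizer, combined with complementary slackness. -/
theorem lagrangian_quadratic_growth {d : ℕ} (X : Set (EuclideanSpace ℝ (Fin d)))
    (hX : Convex ℝ X) (f g : EuclideanSpace ℝ (Fin d) → ℝ) (ρ ρhat lam : ℝ)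
    (x xhat : EuclideanSpace ℝ (Fin d))
    (hρ : 0 ≤ ρ) (hρhat : ρ < ρhat) (hlam : 0 ≤ lam)
    (hf : ConvexOn ℝ X (fun z => f z + ρ / 2 * ‖z‖ ^ 2))
    (hg : ConvexOn ℝ X (fun z => g z + ρ / 2 * ‖z‖ ^ 2))
    (hxX : x ∈ X) (hxhatX : xhat ∈ X)
    (hmin : ∀ y ∈ X,
      f xhat + ρhat / 2 * ‖xhat - x‖ ^ 2 + lam * (g xhat + ρhat / 2 * ‖xhat - x‖ ^ 2)
        ≤ f y + ρhat / 2 * ‖y - x‖ ^ 2 + lam * (g y + ρhat / 2 * ‖y - x‖ ^ 2))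
    (hcs : lam * (g xhat + ρhat / 2 * ‖xhat - x‖ ^ 2) = 0) :
    (1 + lam) * (ρhat - ρ) / 2 * ‖x - xhat‖ ^ 2
      ≤ f x - f xhat + lam * g x - ρhat / 2 * ‖xhat - x‖ ^ 2 := by
  have hL : ConvexOn ℝ X (fun z => (f z + lam * g z) + (1 + lam) * ρ / 2 * ‖z‖ ^ 2) := by
    refine (hf.add (hg.smul hlam)).congr fun z _ => ?_
    simp only [Pi.add_apply, smul_eq_mul]
    ring
  have hmin' : IsMinOn
      (fun z => (f z + lam * g z) + (1 + lam) * ρhat / 2 * ‖z - x‖ ^ 2) X xhat := by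
    refine isMinOn_iff.2 fun y hy => ?_
    linarith [hmin y hy]
  have hgrowth := (hL.strongConvexOn_add_sq_norm_sub ((1 + lam) * ρhat) x).add_sq_le_of_isMinOn
    hmin' hxhatX hxX
  simp only [sub_self, norm_zero] at hgrowth
  linarith
end

section
/- Let X ⊆ ℝ^d be a convex set, let f, g : ℝ^d → ℝ be ρ-weakly convex on X with ρ ≥ 0, let ρ̂ > ρ, λ ≥ 0, ε̂ > 0 and x ∈ X. Define L(y) = f(y) + (ρ̂/2)‖y − x‖² + λ (g(y) + (ρ̂/2)‖y − x‖²). Suppose x̂ ∈ X satisfies L(x̂) ≤ L(y) for all y ∈ X and λ (g(x̂) + (ρ̂/2)‖x̂ − x‖²) = 0, and suppose x⁺ ∈ X satisfies f(x⁺) + (ρ̂/2)‖x⁺ − x‖² ≤ f(x̂) + (ρ̂/2)‖x̂ − x‖² + ε̂². Then f(x⁺) ≤ f(x) + λ g(x) − ((1 + λ)(ρ̂ − ρ)/2) ‖x − x̂‖² + ε̂². -/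
open scoped RealInnerProductSpace

/-- Along a segment, a weakly convex function lies below its chord up to a quadratic error. -/
lemma ConvexOn.le_chord_add_of_add_sq {E : Type*} [NormedAddCommGroup E] [InnerProductSpace ℝ E]
    {X : Set E} {h : E → ℝ} {ρ : ℝ} (hh : ConvexOn ℝ X (fun z => h z + ρ / 2 * ‖z‖ ^ 2))
    {u v : E} (hu : u ∈ X) (hv : v ∈ X) {t : ℝ} (ht0 : 0 ≤ t) (ht1 : t ≤ 1) :
    h ((1 - t) • u + t • v) ≤
      (1 - t) * h u + t * h v + ρ / 2 * (t * (1 - t) * ‖v - u‖ ^ 2) := by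
  have key := hh.2 hu hv (sub_nonneg.2 ht1) ht0 (by ring)
  have hsq : ‖(1 - t) • u + t • v‖ ^ 2 =
      (1 - t) * ‖u‖ ^ 2 + t * ‖v‖ ^ 2 - t * (1 - t) * ‖v - u‖ ^ 2 := by
    rw [norm_add_sq_real, norm_sub_sq_real, norm_smul, norm_smul, mul_pow, mul_pow,
      real_inner_smul_left, real_inner_smul_right, real_inner_comm u v, Real.norm_eq_abs,
      Real.norm_eq_abs, sq_abs, sq_abs]
    ring
  simp only [smul_eq_mul, hsq] at key
  linarith

/-- An affine bound valid on the open unit interval extends to its left endpoint. -/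
lemma le_of_forall_Ioo_le_add_mul {a b c : ℝ}
    (h : ∀ t : ℝ, 0 < t → t < 1 → a ≤ b + t * c) : a ≤ b := by
  have hlim : Filter.Tendsto (fun t : ℝ => b + t * c) (nhdsWithin 0 (Set.Ioi 0)) (nhds b) := by
    have hc : Continuous fun t : ℝ => b + t * c := by fun_prop
    simpa using (hc.tendsto 0).mono_left nhdsWithin_le_nhds
  refine ge_of_tendsto hlim ?_
  filter_upwards [Ioo_mem_nhdsGT (zero_lt_one' ℝ)] with t ht using h t ht.1 ht.2

/-- Per-iteration descent inequality (PGSMeq3) in the proof of Theorem 1. -/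
theorem per_iteration_descent {d : ℕ} (X : Set (EuclideanSpace ℝ (Fin d)))
    (hX : Convex ℝ X) (f g : EuclideanSpace ℝ (Fin d) → ℝ) (ρ ρhat lam εhat : ℝ)
    (x xhat xplus : EuclideanSpace ℝ (Fin d))
    (hρ : 0 ≤ ρ) (hρhat : ρ < ρhat) (hlam : 0 ≤ lam) (hεhat : 0 < εhat)
    (hf : ConvexOn ℝ X (fun z => f z + ρ / 2 * ‖z‖ ^ 2))
    (hg : ConvexOn ℝ X (fun z => g z + ρ / 2 * ‖z‖ ^ 2))
    (hxX : x ∈ X) (hxhatX : xhat ∈ X) (hxplusX : xplus ∈ X)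
    (hmin : ∀ y ∈ X,
      f xhat + ρhat / 2 * ‖xhat - x‖ ^ 2 + lam * (g xhat + ρhat / 2 * ‖xhat - x‖ ^ 2)
        ≤ f y + ρhat / 2 * ‖y - x‖ ^ 2 + lam * (g y + ρhat / 2 * ‖y - x‖ ^ 2))
    (hcs : lam * (g xhat + ρhat / 2 * ‖xhat - x‖ ^ 2) = 0)
    (horacle : f xplus + ρhat / 2 * ‖xplus - x‖ ^ 2
        ≤ f xhat + ρhat / 2 * ‖xhat - x‖ ^ 2 + εhat ^ 2) :
    f xplus ≤ f x + lam * g x - (1 + lam) * (ρhat - ρ) / 2 * ‖x - xhat‖ ^ 2 + εhat ^ 2 := by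
  have growth : f xhat + lam * g xhat + (1 + lam) * ρhat * ‖x - xhat‖ ^ 2 ≤
      f x + lam * g x + (1 + lam) * ρ / 2 * ‖x - xhat‖ ^ 2 := by
    refine le_of_forall_Ioo_le_add_mul
      (c := (1 + lam) * (ρhat - ρ) / 2 * ‖x - xhat‖ ^ 2) fun t ht0 ht1 => ?_
    have hf' := hf.le_chord_add_of_add_sq hxhatX hxX ht0.le ht1.le
    have hg' := mul_le_mul_of_nonneg_left
      (hg.le_chord_add_of_add_sq hxhatX hxX ht0.le ht1.le) hlam
    have hy := hmin _ (hX hxhatX hxX (sub_nonneg.2 ht1.le) ht0.le (by ring))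
    have hsq : ‖(1 - t) • xhat + t • x - x‖ ^ 2 = (1 - t) ^ 2 * ‖x - xhat‖ ^ 2 := by
      have hvec : (1 - t) • xhat + t • x - x = (1 - t) • (xhat - x) := by module
      rw [hvec, norm_smul, mul_pow, Real.norm_eq_abs, sq_abs, norm_sub_rev]
    rw [hsq, norm_sub_rev xhat x] at hy
    refine le_of_mul_le_mul_left ?_ ht0
    linarith
  have hprox : 0 ≤ ρhat / 2 * ‖xplus - x‖ ^ 2 :=
    mul_nonneg (by linarith) (sq_nonneg _)
  rw [norm_sub_rev xhat x] at hcs horacle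
  linarith
end

section
/- Let X ⊆ ℝ^d be a convex set, μ > 0, C ≥ 0, k ∈ ℕ, and let z, x̂ ∈ X and v ∈ ℝ^d with ‖v‖² ≤ 2C. Let F : ℝ^d → ℝ satisfy F(x̂) ≥ F(z) + ⟪v, x̂ − z⟫ + (μ/2)‖x̂ − z‖². Set γ = 2/(μ(k+2)) and suppose z' ∈ X satisfies ⟪(z − γ v) − z', y − z'⟫ ≤ 0 for all y ∈ X. Then (k+1)(F(z) − F(x̂)) ≤ 2C/μ + (μ k (k+1)/4)‖z − x̂‖² − (μ (k+1)(k+2)/4)‖z' − x̂‖². -/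
open scoped RealInnerProductSpace

/-- A point `p` satisfying the variational inequality of the projection of `u` at `x` is no farther
from `x` than `u` is. -/
theorem norm_sub_sq_le_of_inner_sub_nonpos {E : Type*} [NormedAddCommGroup E]
    [InnerProductSpace ℝ E] {u p x : E} (h : ⟪u - p, x - p⟫ ≤ 0) :
    ‖p - x‖ ^ 2 ≤ ‖u - x‖ ^ 2 := by
  have hexp := norm_sub_sq_real (u - p) (x - p)
  rw [sub_sub_sub_cancel_right, norm_sub_rev x p] at hexp
  nlinarith [sq_nonneg ‖u - p‖]

/-- One step of the projected subgradient method with step size `γ`, before cancelling `γ`. -/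
theorem norm_sub_sq_le_of_subgradient_step {E : Type*} [NormedAddCommGroup E]
    [InnerProductSpace ℝ E] {z v p x : E} {γ : ℝ} (h : ⟪(z - γ • v) - p, x - p⟫ ≤ 0) :
    ‖p - x‖ ^ 2 ≤ ‖z - x‖ ^ 2 + 2 * γ * ⟪v, x - z⟫ + γ ^ 2 * ‖v‖ ^ 2 := by
  have hle := norm_sub_sq_le_of_inner_sub_nonpos h
  rw [sub_right_comm, norm_sub_sq_real (z - x), norm_smul, mul_pow, Real.norm_eq_abs, sq_abs,
    real_inner_smul_right, real_inner_comm] at hle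
  rw [← neg_sub z x, inner_neg_right]
  linarith

/-- Weighted one-step telescoping inequality (MDFside) with step size γ = 2/(μ(k+2)). -/
theorem projected_subgradient_weighted_step {d : ℕ} (X : Set (EuclideanSpace ℝ (Fin d)))
    (hX : Convex ℝ X) (μ C : ℝ) (k : ℕ) (hμ : 0 < μ) (hC : 0 ≤ C)
    (z xhat z' v : EuclideanSpace ℝ (Fin d))
    (hzX : z ∈ X) (hxhatX : xhat ∈ X) (hz'X : z' ∈ X)
    (hv : ‖v‖ ^ 2 ≤ 2 * C)
    (F : EuclideanSpace ℝ (Fin d) → ℝ)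
    (hF : F xhat ≥ F z + ⟪v, xhat - z⟫ + μ / 2 * ‖xhat - z‖ ^ 2)
    (hproj : ∀ y ∈ X, ⟪(z - (2 / (μ * ((k : ℝ) + 2))) • v) - z', y - z'⟫ ≤ 0) :
    ((k : ℝ) + 1) * (F z - F xhat)
      ≤ 2 * C / μ + μ * (k : ℝ) * ((k : ℝ) + 1) / 4 * ‖z - xhat‖ ^ 2
        - μ * ((k : ℝ) + 1) * ((k : ℝ) + 2) / 4 * ‖z' - xhat‖ ^ 2 := by
  have hstep := norm_sub_sq_le_of_subgradient_step (hproj xhat hxhatX)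
  rw [norm_sub_rev xhat z] at hF
  have hscaled := mul_le_mul_of_nonneg_left hstep
    (by positivity : 0 ≤ μ * ((k : ℝ) + 1) * (k + 2) / 4)
  have hcancel : μ * ((k : ℝ) + 1) * (k + 2) / 4 * (‖z - xhat‖ ^ 2
        + 2 * (2 / (μ * (k + 2))) * ⟪v, xhat - z⟫ + (2 / (μ * (k + 2))) ^ 2 * ‖v‖ ^ 2)
      = μ * (k + 1) * (k + 2) / 4 * ‖z - xhat‖ ^ 2 + (k + 1) * ⟪v, xhat - z⟫
        + (k + 1) / (k + 2) * (‖v‖ ^ 2 / μ) := by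
    field_simp
    ring
  have hnoise : ((k : ℝ) + 1) / (k + 2) * (‖v‖ ^ 2 / μ) ≤ 2 * C / μ :=
    calc ((k : ℝ) + 1) / (k + 2) * (‖v‖ ^ 2 / μ) ≤ 1 * (‖v‖ ^ 2 / μ) := by
          gcongr
          exact div_le_one_of_le₀ (by linarith) (by positivity)
      _ ≤ 2 * C / μ := by
          rw [one_mul]
          gcongr
  have hconv := mul_le_mul_of_nonneg_left hF (by positivity : 0 ≤ (k : ℝ) + 1)
  linarith
end
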